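/- A probability measure μ on ℝ belongs to P₁ if and only if the function z ↦ G_μ(1/z), defined for z in the upper half-plane, has an analytic continuation to a disc {|z| < r} for some r > 0. -/

import Mathlib

open MeasureTheory Complex

/-- Condition (A2): the density `p` has the form `p x = ∑ₙ aₙ/xⁿ` (with `a₀ = a₁ = 0`),
absolutely convergent for `|x| > r`, and `p` is nonnegative on `|x| ≥ R`. -/
structure A2 (p : ℝ → ℝ) (a : ℕ → ℝ) (r R : ℝ) : Prop where
  hr : 0 < r
  hrR : r < R
  ha0 : a 0 = 0
  ha1 : a 1 = 0
  hsum : ∀ x : ℝ, r < |x| → HasSum (fun n => a n / x ^ n) (p x)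
  habs : ∀ x : ℝ, r < |x| → Summable (fun n => |a n| / |x| ^ n)
  hpos : ∀ x : ℝ, R ≤ |x| → 0 ≤ p x

/-- The measure `λ(dx) = p(x) 1_{|x| ≥ R} dx`. -/
noncomputable def tailMeasure (p : ℝ → ℝ) (R : ℝ) : Measure ℝ :=
  volume.withDensity (fun x => ENNReal.ofReal (if R ≤ |x| then p x else 0))

/-- The complex extension `p(z) = ∑ₙ aₙ/zⁿ` of the density. -/
noncomputable def pC (a : ℕ → ℝ) (z : ℂ) : ℂ := ∑' n : ℕ, (a n : ℂ) / z ^ n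

/-- The complex extension of `u ↦ p(1/u)`, i.e. `∑ₙ aₙ uⁿ`. -/
noncomputable def pCInv (a : ℕ → ℝ) (u : ℂ) : ℂ := ∑' n : ℕ, (a n : ℂ) * u ^ n

/-- Contour integral over the circular arc of radius `c` centred at `0`,
with angle running from `θ₁` to `θ₂`. -/
noncomputable def arcInt (θ₁ θ₂ c : ℝ) (f : ℂ → ℂ) : ℂ :=
  ∫ θ in θ₁..θ₂, (Complex.I * c * Complex.exp (θ * Complex.I)) *
    f (c * Complex.exp (θ * Complex.I))

/-- The Stieltjes transform of a measure on `ℝ`. -/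
noncomputable def stieltjes (μ : Measure ℝ) (z : ℂ) : ℂ :=
  ∫ x, (z - x)⁻¹ ∂μ

/-- The class `P₁`: probability measures of the form `ν + λ` with `ν` a compactly supported
positive measure and `λ` satisfying (A2). -/
def memP1 (μ : Measure ℝ) : Prop :=
  ∃ (ν : Measure ℝ) (p : ℝ → ℝ) (a : ℕ → ℝ) (r R : ℝ),
    A2 p a r R ∧ (∃ K : Set ℝ, IsCompact K ∧ ν Kᶜ = 0) ∧
    μ = ν + tailMeasure p R

section

open Metric Set Filter Topology

/-- A parameter integral of a uniformly bounded family of holomorphic functions over a finite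
measure is holomorphic. -/
theorem differentiableOn_integral_of_norm_le {α : Type*} [MeasurableSpace α] {μ : Measure α}
    [IsFiniteMeasure μ] {U : Set ℂ} (hU : IsOpen U) {F : ℂ → α → ℂ} {C : ℝ}
    (hm : ∀ z ∈ U, AEStronglyMeasurable (F z) μ)
    (hd : ∀ᵐ x ∂μ, DifferentiableOn ℂ (fun z => F z x) U)
    (hb : ∀ᵐ x ∂μ, ∀ z ∈ U, ‖F z x‖ ≤ C) :
    DifferentiableOn ℂ (fun z => ∫ x, F z x ∂μ) U := by
  intro z₀ hz₀
  obtain ⟨ε, hε, hball⟩ := Metric.isOpen_iff.1 hU z₀ hz₀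
  have hint : Integrable (F z₀) μ := by
    refine Integrable.mono' (integrable_const C) (hm z₀ hz₀) ?_
    filter_upwards [hb] with x hx using hx z₀ hz₀
  have hmeas : AEStronglyMeasurable (fun x => deriv (fun z => F z x) z₀) μ := by
    have ht : ∀ n : ℕ, z₀ + ((ε / 2 / (n + 1) : ℝ) : ℂ) ∈ U := fun n => by
      apply hball
      rw [mem_ball, dist_eq_norm, add_sub_cancel_left, Complex.norm_real, Real.norm_of_nonneg
        (by positivity)]
      have : ε / 2 / ((n : ℝ) + 1) ≤ ε / 2 := div_le_self (by positivity) (by linarith [n.cast_nonneg (α := ℝ)])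
      linarith
    refine aestronglyMeasurable_of_tendsto_ae atTop
      (f := fun (n : ℕ) x => ((ε / 2 / (n + 1) : ℝ) : ℂ)⁻¹ •
        (F (z₀ + ((ε / 2 / (n + 1) : ℝ) : ℂ)) x - F z₀ x)) (fun n => ?_) ?_
    · exact ((hm _ (ht n)).sub (hm _ hz₀)).const_smul (((ε / 2 / (n + 1) : ℝ) : ℂ)⁻¹)
    · filter_upwards [hd] with x hx
      have h1 := (hx.differentiableAt (hU.mem_nhds hz₀)).hasDerivAt
      rw [hasDerivAt_iff_tendsto_slope_zero] at h1
      refine h1.comp (tendsto_nhdsWithin_iff.2 ⟨?_, Eventually.of_forall fun n => ?_⟩)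
      · have h2 := (tendsto_one_div_add_atTop_nhds_zero_nat (𝕜 := ℝ)).const_mul (ε / 2)
        rw [mul_zero] at h2
        have h3 := (Complex.continuous_ofReal.tendsto 0).comp h2
        simpa [Function.comp_def, div_eq_mul_inv] using h3
      · have : (0 : ℝ) < ε / 2 / (n + 1) := by positivity
        simpa using (Complex.ofReal_ne_zero.2 this.ne')
  refine (hasDerivAt_integral_of_dominated_loc_of_deriv_le (ball_mem_nhds z₀ (half_pos hε))
    (eventually_of_mem (hU.mem_nhds hz₀) hm) hint (F' := fun z x => deriv (fun z => F z x) z) hmeas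
    (bound := fun _ => C / (ε / 4)) ?_ (integrable_const _) ?_).2.differentiableAt.differentiableWithinAt
  · filter_upwards [hd, hb] with x hx hx' z hz
    have hsub : closedBall z (ε / 4) ⊆ U := fun w hw => hball (by
      rw [mem_closedBall] at hw
      rw [mem_ball] at hz ⊢
      linarith [dist_triangle w z z₀])
    refine Complex.norm_deriv_le_of_forall_mem_sphere_norm_le (by positivity) ?_ fun w hw =>
      hx' w (hsub (sphere_subset_closedBall hw))
    exact (hx.mono hsub).diffContOnCl_ball subset_rfl
  · filter_upwards [hd] with x hx z hz
    exact (hx.differentiableAt (hU.mem_nhds (hball (ball_subset_ball (by linarith) hz)))).hasDerivAt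

/-- The Stieltjes transform of a compactly supported measure is holomorphic near infinity. -/
theorem differentiableOn_stieltjes_inv_of_ae_abs_le {ν : Measure ℝ} [IsFiniteMeasure ν] {M : ℝ}
    (hM : 0 < M) (hν : ∀ᵐ x ∂ν, |x| ≤ M) :
    DifferentiableOn ℂ (fun z : ℂ => ∫ x : ℝ, z * (1 - z * (x : ℂ))⁻¹ ∂ν) (ball 0 (1 / (2 * M))) := by
  have key : ∀ z ∈ ball (0 : ℂ) (1 / (2 * M)), ∀ x : ℝ, |x| ≤ M → 1 / 2 ≤ ‖1 - z * x‖ := by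
    intro z hz x hx
    rw [mem_ball_zero_iff] at hz
    have h1 : ‖z * (x : ℂ)‖ ≤ 1 / 2 := by
      rw [norm_mul, Complex.norm_real, Real.norm_eq_abs]
      calc ‖z‖ * |x| ≤ 1 / (2 * M) * M := by gcongr
        _ = 1 / 2 := by field_simp
    have h2 := norm_sub_norm_le (1 : ℂ) (z * x)
    rw [norm_one] at h2
    linarith
  refine differentiableOn_integral_of_norm_le isOpen_ball (C := 1 / M) (fun z _ => ?_) ?_ ?_
  · exact Measurable.aestronglyMeasurable (by fun_prop)
  · filter_upwards [hν] with x hx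
    intro z hz
    have h0 : 1 - z * x ≠ 0 := norm_pos_iff.1 (by linarith [key z hz x hx])
    have h1 : DifferentiableAt ℂ (fun w : ℂ => 1 - w * (x : ℂ)) z := by fun_prop
    exact (differentiableAt_id.mul (h1.inv h0)).differentiableWithinAt
  · filter_upwards [hν] with x hx z hz
    have h0 := key z hz x hx
    rw [mem_ball_zero_iff] at hz
    rw [norm_mul, norm_inv]
    calc ‖z‖ * ‖1 - z * x‖⁻¹ ≤ 1 / (2 * M) * (1 / 2)⁻¹ := by gcongr
      _ = 1 / M := by field_simp

theorem dslope_comm (f : ℂ → ℂ) (a b : ℂ) : dslope f a b = dslope f b a := by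
  rcases eq_or_ne a b with rfl | h
  · rfl
  · rw [dslope_of_ne _ h, dslope_of_ne _ h.symm, slope_comm]

/-- The Cauchy transform, over a real segment, of a function holomorphic near the segment
continues holomorphically from the upper half-plane across the segment. -/
theorem exists_continuation_cauchy_integral {f : ℂ → ℂ} {δ ρ : ℝ} (hδ : 0 < δ) (hδρ : δ < ρ)
    (hf : DifferentiableOn ℂ f (ball 0 ρ)) :
    ∃ H : ℂ → ℂ, DifferentiableOn ℂ H (ball 0 δ) ∧ ∀ z ∈ ball (0 : ℂ) δ, 0 < z.im →
      ∫ u : ℝ in Icc (-δ) δ, f u / (u - z) = H z := by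
  have hsub : closedBall (0 : ℂ) δ ⊆ ball 0 ρ := closedBall_subset_ball hδρ
  have hmem : ∀ u ∈ Icc (-δ) δ, (u : ℂ) ∈ closedBall (0 : ℂ) δ := fun u hu => by
    simpa [abs_le] using hu
  obtain ⟨C, hC⟩ := (isCompact_closedBall (0 : ℂ) δ).exists_bound_of_continuousOn
    ((hf.deriv isOpen_ball).continuousOn.mono hsub)
  have hbound : ∀ u ∈ closedBall (0 : ℂ) δ, ∀ z ∈ closedBall (0 : ℂ) δ, ‖dslope f u z‖ ≤ C := by
    intro u hu z hz
    rcases eq_or_ne z u with rfl | h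
    · rw [dslope_same]; exact hC _ hz
    · rw [dslope_of_ne _ h, slope_def_module, norm_smul, norm_inv,
        inv_mul_le_iff₀ (norm_pos_iff.2 (sub_ne_zero.2 h)), mul_comm]
      exact (convex_closedBall (0 : ℂ) δ).norm_image_sub_le_of_norm_deriv_le
        (fun w hw => hf.differentiableAt (isOpen_ball.mem_nhds (hsub hw))) hC hu hz
  have hds : ∀ w ∈ closedBall (0 : ℂ) δ, DifferentiableOn ℂ (dslope f w) (ball 0 ρ) := fun w hw =>
    (Complex.differentiableOn_dslope (isOpen_ball.mem_nhds (hsub hw))).2 hf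
  have hcont : ∀ z ∈ ball (0 : ℂ) δ, ContinuousOn (fun u : ℝ => dslope f u z) (Icc (-δ) δ) := by
    intro z hz
    simp_rw [fun u : ℝ => dslope_comm f u z]
    exact (hds z (ball_subset_closedBall hz)).continuousOn.comp Complex.continuous_ofReal.continuousOn
      fun u hu => hsub (hmem u hu)
  refine ⟨fun z => (∫ u : ℝ in Icc (-δ) δ, dslope f u z) +
    f z * (Complex.log (I * (δ - z)) - Complex.log (I * (-δ - z))), ?_, ?_⟩
  · refine DifferentiableOn.add ?_ (DifferentiableOn.mul (hf.mono (ball_subset_ball hδρ.le)) ?_)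
    · refine differentiableOn_integral_of_norm_le isOpen_ball (C := C) (fun z hz => ?_) ?_ ?_
      · exact (hcont z hz).aestronglyMeasurable measurableSet_Icc
      · refine (ae_restrict_iff' measurableSet_Icc).2 (Eventually.of_forall fun u hu => ?_)
        exact (hds u (hmem u hu)).mono (ball_subset_ball hδρ.le)
      · refine (ae_restrict_iff' measurableSet_Icc).2 (Eventually.of_forall fun u hu z hz => ?_)
        exact hbound u (hmem u hu) z (ball_subset_closedBall hz)
    · intro z hz
      rw [mem_ball_zero_iff] at hz
      have hre := (abs_le.1 (Complex.abs_re_le_norm z))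
      refine DifferentiableAt.differentiableWithinAt (DifferentiableAt.sub ?_ ?_)
      · refine DifferentiableAt.clog (by fun_prop) (Or.inr ?_)
        simp
        linarith
      · refine DifferentiableAt.clog (by fun_prop) (Or.inr ?_)
        simp
        linarith
  · intro z hz him
    have hne : ∀ u : ℝ, (u : ℂ) - z ≠ 0 := fun u h => by
      have := congrArg Complex.im h
      simp at this
      linarith
    have hcinv : Continuous fun u : ℝ => ((u : ℂ) - z)⁻¹ :=
      Continuous.inv₀ (by fun_prop) hne
    have hlog : ∫ u : ℝ in Icc (-δ) δ, ((u : ℂ) - z)⁻¹ =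
        Complex.log (I * (δ - z)) - Complex.log (I * (-δ - z)) := by
      rw [integral_Icc_eq_integral_Ioc, ← intervalIntegral.integral_of_le (by linarith)]
      have := intervalIntegral.integral_eq_sub_of_hasDerivAt (a := -δ) (b := δ)
        (f := fun u : ℝ => Complex.log (I * (u - z))) (f' := fun u : ℝ => ((u : ℂ) - z)⁻¹)
        (fun u _ => ?_) (hcinv.intervalIntegrable _ _)
      · simpa using this
      · have h1 : HasDerivAt (fun u : ℝ => I * ((u : ℂ) - z)) (I * 1) u :=
          (((hasDerivAt_id u).ofReal_comp).sub_const z).const_mul I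
        have h2 := h1.clog_real (Or.inl (by simpa using him))
        rw [mul_div_mul_left _ _ I_ne_zero, one_div] at h2
        exact h2
    have hsplit : ∀ u : ℝ, f u / (u - z) = dslope f u z + f z * ((u : ℂ) - z)⁻¹ := fun u => by
      rw [dslope_of_ne _ (sub_ne_zero.1 (hne u)).symm, slope_def_field]
      have h3 : z - u ≠ 0 := by rw [← neg_sub]; exact neg_ne_zero.2 (hne u)
      field_simp [hne u]
      ring
    simp_rw [hsplit]
    rw [integral_add, integral_const_mul, hlog]
    · exact (hcont z hz).integrableOn_Icc
    · exact (continuous_const.mul hcinv).continuousOn.integrableOn_Icc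

namespace A2

variable {p : ℝ → ℝ} {a : ℕ → ℝ} {r R : ℝ}

theorem measurable_density (h : A2 p a r R) :
    Measurable fun x : ℝ => if R ≤ |x| then p x else 0 := by
  refine measurable_of_tendsto_metrizable
    (f := fun (N : ℕ) (x : ℝ) => if R ≤ |x| then ∑ n ∈ Finset.range N, a n / x ^ n else 0)
    (fun N => ?_) ?_
  · exact Measurable.ite (measurableSet_le measurable_const measurable_norm)
      (Finset.measurable_fun_sum _ fun n _ => by fun_prop) measurable_const
  · rw [tendsto_pi_nhds]
    intro x
    by_cases hx : R ≤ |x|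
    · simpa [hx] using (h.hsum x (h.hrR.trans_le hx)).tendsto_sum_nat
    · simp [hx]

theorem differentiableOn_tsum (h : A2 p a r R) {s : ℝ} (hs : r < s) :
    DifferentiableOn ℂ (fun u : ℂ => ∑' n : ℕ, (a (n + 1) : ℂ) * u ^ n) (ball 0 (1 / s)) := by
  have hs0 : 0 < s := h.hr.trans hs
  have hsum := (h.habs s (by rwa [abs_of_pos hs0])).comp_injective (add_left_injective 1)
  rw [abs_of_pos hs0] at hsum
  refine differentiableOn_tsum_of_summable_norm (hsum.mul_left s) (fun n => by fun_prop)
    isOpen_ball fun n w hw => ?_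
  rw [mem_ball_zero_iff] at hw
  rw [norm_mul, norm_pow, Complex.norm_real, Real.norm_eq_abs]
  calc |a (n + 1)| * ‖w‖ ^ n ≤ |a (n + 1)| * (1 / s) ^ n := by gcongr
    _ = s * (|a (n + 1)| / s ^ (n + 1)) := by
      rw [one_div, inv_pow, pow_succ]
      field_simp

theorem ofReal_eq (h : A2 p a r R) {u : ℝ} (hu : r < |u⁻¹|) :
    (p u⁻¹ : ℂ) = u * ∑' n : ℕ, (a (n + 1) : ℂ) * (u : ℂ) ^ n := by
  have h1 := (Complex.hasSum_ofReal (f := fun n => a n / u⁻¹ ^ n)).2 (h.hsum _ hu)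
  have h2 := (hasSum_nat_add_iff' (f := fun n => ((a n / u⁻¹ ^ n : ℝ) : ℂ)) 1).2 h1
  rw [← tsum_mul_left]
  simp [h.ha0] at h2
  rw [← h2.tsum_eq]
  congr 1
  ext n
  ring

theorem integral_tailMeasure (h : A2 p a r R) {z : ℂ} (hz : 0 < z.im) :
    ∫ x : ℝ, (z⁻¹ - x)⁻¹ ∂(tailMeasure p R) =
      z * ∫ u : ℝ in Icc (-(1 / R)) (1 / R),
        (∑' n : ℕ, (a (n + 1) : ℂ) * (u : ℂ) ^ n) / (u - z) := by
  have hR : 0 < R := h.hr.trans h.hrR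
  have hz0 : z ≠ 0 := fun h0 => by simp [h0] at hz
  have himg : (fun u : ℝ => u⁻¹) '' (Icc (-(1 / R)) (1 / R) \ {0}) = {x | R ≤ |x|} := by
    ext x
    simp only [Set.mem_image, Set.mem_sdiff, mem_Icc, mem_singleton_iff, mem_ofPred_eq]
    constructor
    · rintro ⟨u, ⟨hu, hu0⟩, rfl⟩
      rw [abs_inv]
      refine (le_inv_comm₀ hR (abs_pos.2 hu0)).2 ?_
      simpa using abs_le.2 hu
    · intro hx
      have hx0 : x ≠ 0 := fun h0 => by simp [h0] at hx; linarith
      refine ⟨x⁻¹, ⟨abs_le.1 ?_, inv_ne_zero hx0⟩, inv_inv x⟩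
      rw [abs_inv, one_div]
      gcongr
  have hSm : MeasurableSet (Icc (-(1 / R)) (1 / R) \ {(0 : ℝ)}) :=
    measurableSet_Icc.diff (measurableSet_singleton 0)
  have hTm : MeasurableSet {x : ℝ | R ≤ |x|} := measurableSet_le measurable_const measurable_norm
  calc ∫ x : ℝ, (z⁻¹ - x)⁻¹ ∂(tailMeasure p R)
      = ∫ x : ℝ, {x : ℝ | R ≤ |x|}.indicator (fun x => (p x : ℂ) * (z⁻¹ - x)⁻¹) x := by
        rw [tailMeasure, integral_withDensity_eq_integral_toReal_smul
          h.measurable_density.ennreal_ofReal (by simp)]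
        congr 1
        ext x
        by_cases hx : R ≤ |x|
        · simp [hx, h.hpos x hx]
        · simp [hx]
    _ = ∫ x : ℝ in (fun u : ℝ => u⁻¹) '' (Icc (-(1 / R)) (1 / R) \ {0}),
          (p x : ℂ) * (z⁻¹ - x)⁻¹ := by rw [himg, integral_indicator hTm]
    _ = ∫ u : ℝ in Icc (-(1 / R)) (1 / R) \ {0},
          |-(u ^ 2)⁻¹| • ((p u⁻¹ : ℂ) * (z⁻¹ - (u⁻¹ : ℝ))⁻¹) :=
        integral_image_eq_integral_abs_deriv_smul hSm
          (fun u hu => (hasDerivAt_inv hu.2).hasDerivWithinAt) inv_injective.injOn _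
    _ = ∫ u : ℝ in Icc (-(1 / R)) (1 / R) \ {0},
          z * ((∑' n : ℕ, (a (n + 1) : ℂ) * (u : ℂ) ^ n) / (u - z)) := by
        refine setIntegral_congr_fun hSm fun u hu => ?_
        have hu0 : (u : ℂ) ≠ 0 := Complex.ofReal_ne_zero.2 hu.2
        have hur : r < |u⁻¹| := h.hrR.trans_le
          (show u⁻¹ ∈ {x : ℝ | R ≤ |x|} from himg ▸ mem_image_of_mem _ hu)
        have hne : (u : ℂ) - z ≠ 0 := fun h0 => by
          have := congrArg Complex.im h0
          simp at this
          linarith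
        have hinv : z⁻¹ - (u : ℂ)⁻¹ = (u - z) / (z * u) := by field_simp
        simp only [h.ofReal_eq hur, abs_neg, abs_inv, abs_pow, sq_abs, Complex.real_smul,
          Complex.ofReal_inv, Complex.ofReal_pow, hinv]
        field_simp
    _ = _ := by
        rw [integral_const_mul, setIntegral_congr_set]
        exact sdiff_null_ae_eq_self (by simp)

end A2

theorem integrable_inv_sub_ofReal (μ : Measure ℝ) [IsFiniteMeasure μ] {w : ℂ} (hw : w.im ≠ 0) :
    Integrable (fun x : ℝ => (w - x)⁻¹) μ := by
  refine Integrable.mono' (integrable_const |w.im|⁻¹)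
    (Measurable.aestronglyMeasurable (by fun_prop)) (Eventually.of_forall fun x => ?_)
  rw [norm_inv]
  have : |w.im| ≤ ‖w - x‖ := by simpa using Complex.abs_im_le_norm (w - x)
  gcongr

theorem inv_im_ne_zero {z : ℂ} (hz : 0 < z.im) : z⁻¹.im ≠ 0 := by
  have hz0 : z ≠ 0 := fun h0 => by simp [h0] at hz
  simp [Complex.inv_im, hz.ne', hz0]

theorem memP1.exists_continuation {μ : Measure ℝ} [IsFiniteMeasure μ] (hμ : memP1 μ) :
    ∃ r : ℝ, 0 < r ∧ ∃ h : ℂ → ℂ, AnalyticOnNhd ℂ h (ball (0 : ℂ) r) ∧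
      ∀ z : ℂ, 0 < z.im → z ∈ ball (0 : ℂ) r → h z = stieltjes μ z⁻¹ := by
  obtain ⟨ν, p, a, r, R, hA, ⟨K, hK, hνK⟩, rfl⟩ := hμ
  have hR : 0 < R := hA.hr.trans hA.hrR
  have : IsFiniteMeasure ν := isFiniteMeasure_of_le (ν + tailMeasure p R) (Measure.le_add_right le_rfl)
  have : IsFiniteMeasure (tailMeasure p R) :=
    isFiniteMeasure_of_le (ν + tailMeasure p R) (Measure.le_add_left le_rfl)
  obtain ⟨M, hM, hKM⟩ := hK.isBounded.exists_pos_norm_le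
  have hν : ∀ᵐ x ∂ν, |x| ≤ M := by
    have : ∀ᵐ x ∂ν, x ∈ K := hνK
    filter_upwards [this] with x hx using hKM x hx
  have hs : r < (r + R) / 2 := by linarith [hA.hrR]
  have hs0 : 0 < (r + R) / 2 := by linarith [hA.hr]
  obtain ⟨H, hH, hHz⟩ := exists_continuation_cauchy_integral (one_div_pos.2 hR)
    (one_div_lt_one_div_of_lt hs0 (by linarith [hA.hrR])) (hA.differentiableOn_tsum hs)
  refine ⟨min (1 / (2 * M)) (1 / R), by positivity,
    fun z => (∫ x : ℝ, z * (1 - z * (x : ℂ))⁻¹ ∂ν) + z * H z, ?_, fun z hz hzr => ?_⟩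
  · refine DifferentiableOn.analyticOnNhd (DifferentiableOn.add ?_ ?_) isOpen_ball
    · exact (differentiableOn_stieltjes_inv_of_ae_abs_le hM hν).mono
        (ball_subset_ball (min_le_left _ _))
    · exact differentiableOn_id.mul (hH.mono (ball_subset_ball (min_le_right _ _)))
  · have hz0 : z ≠ 0 := fun h0 => by simp [h0] at hz
    rw [stieltjes, integral_add_measure (integrable_inv_sub_ofReal _ (inv_im_ne_zero hz))
      (integrable_inv_sub_ofReal _ (inv_im_ne_zero hz)), hA.integral_tailMeasure hz,
      hHz z (ball_subset_ball (min_le_right _ _) hzr) hz]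
    refine congrArg₂ (· + ·) (integral_congr_ae (Eventually.of_forall fun x => ?_)) rfl
    have : z⁻¹ - x = (1 - z * x) / z := by field_simp
    simp only [this, inv_div]
    ring

theorem im_inv_sub_mul_I_sub (x y t : ℝ) :
    (((x - y * I : ℂ) - t)⁻¹).im = y / ((x - t) ^ 2 + y ^ 2) := by
  rw [Complex.inv_im, Complex.normSq_apply]
  simp
  ring

theorem im_stieltjes (μ : Measure ℝ) [IsFiniteMeasure μ] {x y : ℝ} (hy : 0 < y) :
    (stieltjes μ (x - y * I)).im = ∫ t, y / ((x - t) ^ 2 + y ^ 2) ∂μ := by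
  have h1 := integral_im (𝕜 := ℂ) (integrable_inv_sub_ofReal μ (w := x - y * I) (by simp [hy.ne']))
  simp only [RCLike.im_to_complex, im_inv_sub_mul_I_sub] at h1
  exact h1.symm

theorem integrable_poisson (μ : Measure ℝ) [IsFiniteMeasure μ] {φ : ℝ → ℝ} (hφ : Integrable φ)
    {y : ℝ} (hy : 0 < y) :
    Integrable (Function.uncurry fun x t : ℝ => φ x * (y / ((x - t) ^ 2 + y ^ 2)))
      (volume.prod μ) := by
  have h1 : Integrable (fun z : ℝ × ℝ => φ z.1) (volume.prod μ) := hφ.comp_fst μ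
  refine Integrable.mono' (h1.norm.mul_const (1 / y)) (h1.aestronglyMeasurable.mul
    (Measurable.aestronglyMeasurable (by fun_prop))) (Eventually.of_forall fun z => ?_)
  simp only [Function.uncurry]
  rw [norm_mul]
  refine mul_le_mul_of_nonneg_left ?_ (norm_nonneg _)
  rw [Real.norm_of_nonneg (by positivity), div_le_div_iff₀ (by positivity) hy]
  nlinarith [sq_nonneg (z.1 - z.2)]

theorem integral_mul_poisson (φ : ℝ → ℝ) (t : ℝ) {y : ℝ} (hy : 0 < y) :
    ∫ x, φ x * (y / ((x - t) ^ 2 + y ^ 2)) = ∫ s, φ (y * s + t) * (1 + s ^ 2)⁻¹ := by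
  have h1 := integral_add_right_eq_self (μ := volume)
    (fun x => φ x * (y / ((x - t) ^ 2 + y ^ 2))) t
  have h2 := Measure.integral_comp_mul_left
    (fun x => φ (x + t) * (y / ((x + t - t) ^ 2 + y ^ 2))) y
  rw [eq_comm, abs_inv, abs_of_pos hy, inv_smul_eq_iff₀ hy.ne', smul_eq_mul,
    ← integral_const_mul] at h2
  rw [← h1, h2]
  congr 1
  ext s
  have h3 : (y * s + t - t) ^ 2 + y ^ 2 = y ^ 2 * (1 + s ^ 2) := by ring
  rw [h3]
  field_simp

/-- Stieltjes–Perron inversion, tested against bounded continuous integrable functions. -/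
theorem tendsto_integral_mul_im_stieltjes (μ : Measure ℝ) [IsFiniteMeasure μ] {φ : ℝ → ℝ}
    (hc : Continuous φ) (hφ : Integrable φ) {B : ℝ} (hB : ∀ x, |φ x| ≤ B) :
    Tendsto (fun y : ℝ => ∫ x, φ x * (stieltjes μ (x - y * I)).im) (𝓝[>] 0)
      (𝓝 (∫ t, φ t * Real.pi ∂μ)) := by
  have heq : ∀ᶠ y : ℝ in 𝓝[>] 0, ∫ t, (∫ s, φ (y * s + t) * (1 + s ^ 2)⁻¹) ∂μ =
      ∫ x, φ x * (stieltjes μ (x - y * I)).im := by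
    filter_upwards [self_mem_nhdsWithin] with y hy
    simp_rw [im_stieltjes μ hy, ← integral_const_mul, ← integral_mul_poisson φ _ hy]
    exact (integral_integral_swap (integrable_poisson μ hφ hy)).symm
  refine Tendsto.congr' heq ?_
  have hb : ∀ (y t s : ℝ), ‖φ (y * s + t) * (1 + s ^ 2)⁻¹‖ ≤ B * (1 + s ^ 2)⁻¹ := fun y t s => by
    rw [norm_mul, Real.norm_of_nonneg (by positivity : 0 ≤ (1 + s ^ 2)⁻¹)]
    exact mul_le_mul_of_nonneg_right (hB _) (by positivity)
  have hint : Integrable (fun s : ℝ => B * (1 + s ^ 2)⁻¹) := integrable_inv_one_add_sq.const_mul B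
  have hjoint : ∀ y : ℝ, StronglyMeasurable
      (Function.uncurry fun t s : ℝ => φ (y * s + t) * (1 + s ^ 2)⁻¹) := fun y =>
    Measurable.stronglyMeasurable (by
      have := hc.measurable
      simp only [Function.uncurry_def]
      fun_prop)
  refine tendsto_integral_filter_of_dominated_convergence (fun _ => B * Real.pi)
    (Eventually.of_forall fun y => (hjoint y).integral_prod_right.aestronglyMeasurable)
    (Eventually.of_forall fun y => Eventually.of_forall fun t => ?_) (integrable_const _)
    (Eventually.of_forall fun t => ?_)
  · rw [← integral_univ_inv_one_add_sq, ← integral_const_mul]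
    exact norm_integral_le_of_norm_le hint (Eventually.of_forall (hb y t))
  · rw [← integral_univ_inv_one_add_sq, ← integral_const_mul]
    refine tendsto_integral_filter_of_dominated_convergence _
      (Eventually.of_forall fun y => ?_) (Eventually.of_forall fun y => Eventually.of_forall (hb y t))
      hint (Eventually.of_forall fun s => ?_)
    · exact ((hjoint y).comp_measurable measurable_prodMk_left).aestronglyMeasurable
    · refine Tendsto.mul_const _ ?_
      have h1 : Continuous fun y : ℝ => φ (y * s + t) := by fun_prop
      simpa using (h1.tendsto 0).mono_left nhdsWithin_le_nhds

theorem tendsto_stieltjes_div (μ : Measure ℝ) [IsProbabilityMeasure μ] :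
    Tendsto (fun y : ℝ => (y * I : ℂ)⁻¹ * stieltjes μ (y * I : ℂ)⁻¹) (𝓝[>] 0) (𝓝 1) := by
  have heq : ∀ᶠ y : ℝ in 𝓝[>] 0, ∫ x : ℝ, (1 - y * I * x : ℂ)⁻¹ ∂μ =
      (y * I : ℂ)⁻¹ * stieltjes μ (y * I : ℂ)⁻¹ := by
    filter_upwards [self_mem_nhdsWithin] with y hy
    have hy0 : (y * I : ℂ) ≠ 0 := mul_ne_zero (Complex.ofReal_ne_zero.2 (ne_of_gt hy)) I_ne_zero
    rw [stieltjes, ← integral_const_mul]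
    refine integral_congr_ae (Eventually.of_forall fun x => ?_)
    have h1 : (y * I : ℂ)⁻¹ - x = (y * I)⁻¹ * (1 - y * I * x) := by
      rw [mul_sub, ← mul_assoc, inv_mul_cancel₀ hy0, mul_one, one_mul]
    simp only [h1, mul_inv (y * I : ℂ)⁻¹, inv_inv]
    rw [← mul_assoc, inv_mul_cancel₀ hy0, one_mul]
  refine Tendsto.congr' heq ?_
  have hre : ∀ y x : ℝ, (1 - y * I * x : ℂ).re = 1 := fun y x => by simp
  have h1 : ∫ x : ℝ, (1 : ℂ) ∂μ = 1 := by simp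
  rw [← h1]
  refine tendsto_integral_filter_of_dominated_convergence (fun _ => 1)
    (Eventually.of_forall fun y => Measurable.aestronglyMeasurable (by fun_prop))
    (Eventually.of_forall fun y => Eventually.of_forall fun x => ?_) (integrable_const _)
    (Eventually.of_forall fun x => ?_)
  · rw [norm_inv]
    refine inv_le_one_of_one_le₀ ?_
    simpa [hre y x] using Complex.abs_re_le_norm (1 - y * I * x : ℂ)
  · have h2 : ContinuousAt (fun y : ℝ => (1 - y * I * x : ℂ)⁻¹) 0 :=
      ContinuousAt.inv₀ (by fun_prop) (by simp)
    have h3 := h2.tendsto.mono_left (nhdsWithin_le_nhds (s := Ioi 0))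
    simpa using h3

section Converse

variable {μ : Measure ℝ} {r : ℝ} {h : ℂ → ℂ}

theorem continuation_zero [IsProbabilityMeasure μ]
    (hr : 0 < r) (hh : AnalyticOnNhd ℂ h (ball (0 : ℂ) r))
    (hG : ∀ z : ℂ, 0 < z.im → z ∈ ball (0 : ℂ) r → h z = stieltjes μ z⁻¹) :
    h 0 = 0 ∧ deriv h 0 = 1 := by
  have hd : HasDerivAt h (deriv h 0) 0 :=
    (hh 0 (mem_ball_self hr)).differentiableAt.hasDerivAt
  have hlim : Tendsto (fun y : ℝ => (y * I : ℂ)⁻¹ * h (y * I)) (𝓝[>] 0) (𝓝 1) := by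
    refine (tendsto_stieltjes_div μ).congr' ?_
    filter_upwards [Ioo_mem_nhdsGT hr] with y hy
    rw [hG (y * I) (by simpa using hy.1) (by simpa [abs_of_pos hy.1] using hy.2)]
  have hy0 : Tendsto (fun y : ℝ => (y * I : ℂ)) (𝓝[>] 0) (𝓝 0) := by
    have h1 : Continuous fun y : ℝ => (y * I : ℂ) := by fun_prop
    simpa using (h1.tendsto 0).mono_left (nhdsWithin_le_nhds (s := Ioi 0))
  have hne : ∀ᶠ y : ℝ in 𝓝[>] 0, (y * I : ℂ) ≠ 0 := by
    filter_upwards [self_mem_nhdsWithin] with y hy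
    exact mul_ne_zero (Complex.ofReal_ne_zero.2 (ne_of_gt hy)) I_ne_zero
  have h0 : h 0 = 0 := by
    refine tendsto_nhds_unique (hd.continuousAt.tendsto.comp hy0) ?_
    have h2 := hy0.mul hlim
    rw [zero_mul] at h2
    refine h2.congr' ?_
    filter_upwards [hne] with y hy
    simp only [Function.comp]
    rw [← mul_assoc, mul_inv_cancel₀ hy, one_mul]
  refine ⟨h0, tendsto_nhds_unique (hd.tendsto_slope.comp (tendsto_nhdsWithin_iff.2 ⟨hy0, hne⟩)) ?_⟩
  refine hlim.congr fun y => ?_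
  simp [slope_def_field, h0, div_eq_inv_mul]

/-- The density recovered from a continuation `h` of `z ↦ G_μ(1/z)`, cut off to `|x| > s`. -/
noncomputable def recoveredDensity (h : ℂ → ℂ) (s x : ℝ) : ℝ :=
  {x : ℝ | s < |x|}.piecewise (fun x : ℝ => Real.pi⁻¹ * (h (x : ℂ)⁻¹).im) (fun _ => 0) x

theorem recoveredDensity_of_lt {s x : ℝ} (hx : s < |x|) :
    recoveredDensity h s x = Real.pi⁻¹ * (h (x : ℂ)⁻¹).im :=
  Set.piecewise_eq_of_mem _ _ _ hx

theorem recoveredDensity_of_le {s x : ℝ} (hx : |x| ≤ s) : recoveredDensity h s x = 0 :=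
  Set.piecewise_eq_of_notMem _ _ _ (not_lt.2 hx)

theorem norm_inv_ofReal_sub_le {s x : ℝ} (hs : 0 < s) (hx : s < |x|) (y : ℝ) :
    ‖(x - y * I : ℂ)⁻¹‖ ≤ s⁻¹ := by
  rw [norm_inv]
  have := Complex.abs_re_le_norm (x - y * I : ℂ)
  simp at this
  gcongr
  linarith

theorem inv_ofReal_mem_closedBall {s x : ℝ} (hs : 0 < s) (hx : s < |x|) :
    (x : ℂ)⁻¹ ∈ closedBall (0 : ℂ) s⁻¹ := by
  simpa using norm_inv_ofReal_sub_le hs hx 0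

theorem tendsto_continuation (hh : AnalyticOnNhd ℂ h (ball (0 : ℂ) r)) {s x : ℝ} (hs : 0 < s)
    (hsr : s⁻¹ < r) (hx : s < |x|) :
    Tendsto (fun y : ℝ => h (x - y * I : ℂ)⁻¹) (𝓝[>] 0) (𝓝 (h (x : ℂ)⁻¹)) := by
  have hx0 : (x : ℂ) ≠ 0 := Complex.ofReal_ne_zero.2 (abs_pos.1 (hs.trans hx))
  have h1 : ContinuousAt (fun y : ℝ => (x - y * I : ℂ)⁻¹) 0 :=
    ContinuousAt.inv₀ (by fun_prop) (by simpa using hx0)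
  have h2 := h1.tendsto.mono_left (nhdsWithin_le_nhds (s := Ioi 0))
  simp only [Complex.ofReal_zero, zero_mul, sub_zero] at h2
  exact (hh _ (closedBall_subset_ball hsr (inv_ofReal_mem_closedBall hs hx))).continuousAt.tendsto.comp
    h2

theorem stieltjes_eq_continuation
    (hG : ∀ z : ℂ, 0 < z.im → z ∈ ball (0 : ℂ) r → h z = stieltjes μ z⁻¹) {s x y : ℝ} (hs : 0 < s)
    (hsr : s⁻¹ < r) (hx : s < |x|) (hy : 0 < y) :
    stieltjes μ (x - y * I) = h (x - y * I : ℂ)⁻¹ := by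
  rw [hG, inv_inv]
  · rw [Complex.inv_im]
    have : (x - y * I : ℂ) ≠ 0 := fun h0 => by
      have := congrArg Complex.im h0
      simp at this
      linarith
    have := Complex.normSq_pos.2 this
    simp only [sub_im, ofReal_im, mul_im, ofReal_re, I_im, mul_one, I_re, mul_zero, add_zero,
      zero_sub, neg_neg]
    positivity
  · rw [mem_ball_zero_iff]
    exact (norm_inv_ofReal_sub_le hs hx y).trans_lt hsr

theorem recoveredDensity_nonneg [IsFiniteMeasure μ]
    (hh : AnalyticOnNhd ℂ h (ball (0 : ℂ) r))
    (hG : ∀ z : ℂ, 0 < z.im → z ∈ ball (0 : ℂ) r → h z = stieltjes μ z⁻¹) {s : ℝ} (hs : 0 < s)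
    (hsr : s⁻¹ < r) (x : ℝ) : 0 ≤ recoveredDensity h s x := by
  rcases lt_or_ge s |x| with hx | hx
  · rw [recoveredDensity_of_lt hx]
    refine mul_nonneg (by positivity) ?_
    refine ge_of_tendsto ((Complex.continuous_im.tendsto _).comp (tendsto_continuation hh hs hsr hx)) ?_
    filter_upwards [self_mem_nhdsWithin] with y hy
    simp only [Function.comp]
    rw [← stieltjes_eq_continuation hG hs hsr hx hy, im_stieltjes μ hy]
    have : (0 : ℝ) < y := hy
    exact integral_nonneg fun t => by positivity
  · rw [recoveredDensity_of_le hx]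

theorem measurable_recoveredDensity (hh : AnalyticOnNhd ℂ h (ball (0 : ℂ) r)) {s : ℝ} (hs : 0 < s)
    (hsr : s⁻¹ < r) : Measurable (recoveredDensity h s) := by
  refine ContinuousOn.measurable_piecewise ?_ continuousOn_const
    (measurableSet_lt measurable_const measurable_norm)
  refine continuousOn_const.mul (Complex.continuous_im.comp_continuousOn ?_)
  refine hh.continuousOn.comp (ContinuousOn.inv₀ (by fun_prop) fun x hx => ?_) fun x hx =>
    closedBall_subset_ball hsr (inv_ofReal_mem_closedBall hs hx)
  exact Complex.ofReal_ne_zero.2 (abs_pos.1 (hs.trans hx))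

theorem exists_norm_continuation_le (hh : AnalyticOnNhd ℂ h (ball (0 : ℂ) r)) {s : ℝ}
    (hsr : s⁻¹ < r) : ∃ C, ∀ z ∈ closedBall (0 : ℂ) s⁻¹, ‖h z‖ ≤ C :=
  (isCompact_closedBall (0 : ℂ) s⁻¹).exists_bound_of_continuousOn
    (hh.continuousOn.mono (closedBall_subset_ball hsr))

theorem integral_eq_integral_mul_recoveredDensity [IsFiniteMeasure μ]
    (hh : AnalyticOnNhd ℂ h (ball (0 : ℂ) r))
    (hG : ∀ z : ℂ, 0 < z.im → z ∈ ball (0 : ℂ) r → h z = stieltjes μ z⁻¹) {s : ℝ} (hs : 0 < s)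
    (hsr : s⁻¹ < r) {φ : ℝ → ℝ} (hc : Continuous φ) (hφ : Integrable φ) {B : ℝ}
    (hB : ∀ x, |φ x| ≤ B) (h0 : ∀ x, |x| ≤ s → φ x = 0) :
    ∫ t, φ t ∂μ = ∫ x, φ x * recoveredDensity h s x := by
  obtain ⟨C, hC⟩ := exists_norm_continuation_le hh hsr
  have h1 := tendsto_integral_mul_im_stieltjes μ hc hφ hB
  have h2 : Tendsto (fun y : ℝ => ∫ x, φ x * (stieltjes μ (x - y * I)).im) (𝓝[>] 0)
      (𝓝 (∫ x, φ x * recoveredDensity h s x * Real.pi)) := by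
    refine tendsto_integral_filter_of_dominated_convergence (fun x => ‖φ x‖ * C) ?_ ?_
      (hφ.norm.mul_const C) (Eventually.of_forall fun x => ?_)
    · filter_upwards [self_mem_nhdsWithin] with y hy
      simp_rw [im_stieltjes μ hy, ← integral_const_mul]
      exact (integrable_poisson μ hφ hy).integral_prod_left.aestronglyMeasurable
    · filter_upwards [self_mem_nhdsWithin] with y hy
      refine Eventually.of_forall fun x => ?_
      rcases lt_or_ge s |x| with hx | hx
      · rw [stieltjes_eq_continuation hG hs hsr hx hy, norm_mul]
        refine mul_le_mul_of_nonneg_left ((Complex.abs_im_le_norm _).trans (hC _ ?_))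
          (norm_nonneg _)
        exact mem_closedBall_zero_iff.2 (norm_inv_ofReal_sub_le hs hx y)
      · simp [h0 x hx]
    · rcases lt_or_ge s |x| with hx | hx
      · rw [recoveredDensity_of_lt hx]
        have h3 := ((Complex.continuous_im.tendsto _).comp
          (tendsto_continuation hh hs hsr hx)).const_mul (φ x)
        have h4 : φ x * (Real.pi⁻¹ * (h (x : ℂ)⁻¹).im) * Real.pi = φ x * (h (x : ℂ)⁻¹).im := by
          field_simp
        rw [h4]
        refine h3.congr' ?_
        filter_upwards [self_mem_nhdsWithin] with y hy
        simp only [Function.comp]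
        rw [stieltjes_eq_continuation hG hs hsr hx hy]
      · simp [h0 x hx]
  have h3 := tendsto_nhds_unique h1 h2
  rw [integral_mul_const, integral_mul_const] at h3
  exact mul_right_cancel₀ Real.pi_ne_zero h3

/-- A continuous integrable weight, with values in `[0, 1]`, positive exactly where `|x| > s`. -/
noncomputable def tailWeight (s x : ℝ) : ℝ := min 1 (max 0 (|x| - s)) * (1 + x ^ 2)⁻¹

theorem tailWeight_nonneg (s x : ℝ) : 0 ≤ tailWeight s x := by
  unfold tailWeight; positivity

theorem tailWeight_le (s x : ℝ) : tailWeight s x ≤ (1 + x ^ 2)⁻¹ :=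
  mul_le_of_le_one_left (by positivity) (min_le_left _ _)

theorem tailWeight_le_one (s x : ℝ) : tailWeight s x ≤ 1 :=
  (tailWeight_le s x).trans (inv_le_one_of_one_le₀ (by nlinarith [sq_nonneg x]))

theorem tailWeight_pos {s x : ℝ} (hx : s < |x|) : 0 < tailWeight s x :=
  mul_pos (lt_min one_pos (lt_max_of_lt_right (sub_pos.2 hx))) (by positivity)

theorem tailWeight_eq_zero {s x : ℝ} (hx : |x| ≤ s) : tailWeight s x = 0 := by
  simp [tailWeight, hx]

theorem continuous_tailWeight (s : ℝ) : Continuous (tailWeight s) :=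
  Continuous.mul (by fun_prop) (Continuous.inv₀ (by fun_prop) fun x => by positivity)

theorem integrable_tailWeight (s : ℝ) : Integrable (tailWeight s) :=
  integrable_inv_one_add_sq.mono' (continuous_tailWeight s).aestronglyMeasurable
    (Eventually.of_forall fun x => by
      rw [Real.norm_of_nonneg (tailWeight_nonneg s x)]; exact tailWeight_le s x)

theorem withDensity_tailWeight_eq [IsFiniteMeasure μ]
    (hh : AnalyticOnNhd ℂ h (ball (0 : ℂ) r))
    (hG : ∀ z : ℂ, 0 < z.im → z ∈ ball (0 : ℂ) r → h z = stieltjes μ z⁻¹) {s : ℝ} (hs : 0 < s)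
    (hsr : s⁻¹ < r) :
    μ.withDensity (fun x => ENNReal.ofReal (tailWeight s x)) =
      (volume.withDensity fun x => ENNReal.ofReal (recoveredDensity h s x)).withDensity
        (fun x => ENNReal.ofReal (tailWeight s x)) := by
  have hqm := measurable_recoveredDensity hh hs hsr
  have hq0 := recoveredDensity_nonneg hh hG hs hsr
  have hwm := (continuous_tailWeight s).measurable
  obtain ⟨C, hC⟩ := exists_norm_continuation_le hh hsr
  have hqb : ∀ x, ‖recoveredDensity h s x‖ ≤ Real.pi⁻¹ * |C| := fun x => by
    rcases lt_or_ge s |x| with hx | hx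
    · rw [recoveredDensity_of_lt hx, norm_mul, Real.norm_of_nonneg (by positivity)]
      gcongr
      exact ((Complex.abs_im_le_norm _).trans (hC _ (inv_ofReal_mem_closedBall hs hx))).trans
        (le_abs_self C)
    · rw [recoveredDensity_of_le hx, norm_zero]; positivity
  rw [← withDensity_mul _ hqm.ennreal_ofReal hwm.ennreal_ofReal]
  have hmul : ((fun x => ENNReal.ofReal (recoveredDensity h s x)) *
      fun x => ENNReal.ofReal (tailWeight s x)) =
      fun x => ENNReal.ofReal (recoveredDensity h s x * tailWeight s x) := by
    ext x
    rw [Pi.mul_apply, ENNReal.ofReal_mul (hq0 x)]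
  rw [hmul]
  have hqwm : Measurable fun x => recoveredDensity h s x * tailWeight s x := hqm.mul hwm
  have hint : Integrable fun x => recoveredDensity h s x * tailWeight s x :=
    (integrable_tailWeight s).bdd_mul hqm.aestronglyMeasurable (Eventually.of_forall hqb)
  have hintμ : Integrable (tailWeight s) μ :=
    Integrable.mono' (integrable_const 1) hwm.aestronglyMeasurable
      (Eventually.of_forall fun x => by
        rw [Real.norm_of_nonneg (tailWeight_nonneg s x)]; exact tailWeight_le_one s x)
  have := isFiniteMeasure_withDensity_ofReal hint.2
  have := isFiniteMeasure_withDensity_ofReal hintμ.2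
  refine ext_of_forall_integral_eq_of_IsFiniteMeasure fun g => ?_
  rw [integral_withDensity_eq_integral_toReal_smul hwm.ennreal_ofReal (by simp),
    integral_withDensity_eq_integral_toReal_smul hqwm.ennreal_ofReal (by simp)]
  have hgb : ∀ x, |g x| ≤ ‖g‖ := g.norm_coe_le_norm
  have key := integral_eq_integral_mul_recoveredDensity hh hG hs hsr
    (φ := fun x => g x * tailWeight s x) (g.continuous.mul (continuous_tailWeight s))
    ((integrable_tailWeight s).bdd_mul g.continuous.aestronglyMeasurable
      (Eventually.of_forall hgb)) (B := ‖g‖) (fun x => ?_)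
    (fun x hx => by simp [tailWeight_eq_zero hx])
  · refine (integral_congr_ae (Eventually.of_forall fun x => ?_)).trans
      (key.trans (integral_congr_ae (Eventually.of_forall fun x => ?_)))
    · simp only [ENNReal.toReal_ofReal (tailWeight_nonneg s x), smul_eq_mul, mul_comm]
    · simp only [ENNReal.toReal_ofReal (mul_nonneg (hq0 x) (tailWeight_nonneg s x)), smul_eq_mul]
      ring
  · rw [abs_mul, abs_of_nonneg (tailWeight_nonneg s x)]
    exact (mul_le_of_le_one_right (abs_nonneg _) (tailWeight_le_one s x)).trans (hgb x)

theorem restrict_eq_tailMeasure [IsFiniteMeasure μ]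
    (hh : AnalyticOnNhd ℂ h (ball (0 : ℂ) r))
    (hG : ∀ z : ℂ, 0 < z.im → z ∈ ball (0 : ℂ) r → h z = stieltjes μ z⁻¹) {s R : ℝ} (hs : 0 < s)
    (hsr : s⁻¹ < r) (hsR : s < R) :
    μ.restrict {x | R ≤ |x|} = tailMeasure (recoveredDensity h s) R := by
  have hT : MeasurableSet {x : ℝ | R ≤ |x|} := measurableSet_le measurable_const measurable_norm
  have hwm := (continuous_tailWeight s).measurable.ennreal_ofReal
  have hinv : ∀ m : Measure ℝ, ((m.restrict {x | R ≤ |x|}).withDensity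
      (fun x => ENNReal.ofReal (tailWeight s x))).withDensity
      (fun x => (ENNReal.ofReal (tailWeight s x))⁻¹) = m.restrict {x | R ≤ |x|} := fun m => by
    refine withDensity_inv_same hwm ((ae_restrict_iff' hT).2 (Eventually.of_forall fun x hx => ?_))
      (by simp)
    exact (ENNReal.ofReal_pos.2 (tailWeight_pos (hsR.trans_le hx))).ne'
  rw [← hinv μ, ← restrict_withDensity hT, withDensity_tailWeight_eq hh hG hs hsr,
    restrict_withDensity hT, hinv, restrict_withDensity hT, ← withDensity_indicator hT, tailMeasure]
  congr 1
  ext x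
  by_cases hx : R ≤ |x| <;> simp [hx]

theorem memP1_of_continuation [IsProbabilityMeasure μ]
    (hr : 0 < r) (hh : AnalyticOnNhd ℂ h (ball (0 : ℂ) r))
    (hG : ∀ z : ℂ, 0 < z.im → z ∈ ball (0 : ℂ) r → h z = stieltjes μ z⁻¹) : memP1 μ := by
  obtain ⟨s, hs⟩ := exists_gt r⁻¹
  have hs0 : 0 < s := (inv_pos.2 hr).trans hs
  have hsr : s⁻¹ < r := inv_lt_of_inv_lt₀ hr hs
  have hT : MeasurableSet {x : ℝ | s + 1 ≤ |x|} :=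
    measurableSet_le measurable_const measurable_norm
  have htaylor : ∀ x : ℝ, s < |x| → HasSum
      (fun n : ℕ => ((n.factorial : ℂ)⁻¹ * iteratedDeriv n h 0) * (((x ^ n)⁻¹ : ℝ) : ℂ))
      (h (x : ℂ)⁻¹) := fun x hx => by
    have h1 := Complex.hasSum_taylorSeries_on_ball hh.differentiableOn
      (closedBall_subset_ball hsr (inv_ofReal_mem_closedBall hs0 hx))
    refine h1.congr_fun fun n => ?_
    simp only [sub_zero, smul_eq_mul, inv_pow, Complex.ofReal_inv, Complex.ofReal_pow]
    ring
  obtain ⟨h0, h1⟩ := continuation_zero (μ := μ) hr hh hG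
  refine ⟨μ.restrict {x | s + 1 ≤ |x|}ᶜ, recoveredDensity h s,
    fun n => Real.pi⁻¹ * ((n.factorial : ℂ)⁻¹ * iteratedDeriv n h 0).im, s, s + 1,
    ⟨hs0, by linarith, by simp [h0], by simp [h1], fun x hx => ?_, fun x hx => ?_,
      fun x _ => recoveredDensity_nonneg hh hG hs0 hsr x⟩,
    ⟨Icc (-(s + 1)) (s + 1), isCompact_Icc, ?_⟩, ?_⟩
  · rw [recoveredDensity_of_lt hx]
    refine ((Complex.hasSum_im (htaylor x hx)).mul_left Real.pi⁻¹).congr_fun fun n => ?_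
    rw [Complex.im_mul_ofReal, div_eq_mul_inv, mul_assoc]
  · refine Summable.of_nonneg_of_le (fun n => by positivity) (fun n => ?_)
      ((htaylor x hx).summable.norm.mul_left Real.pi⁻¹)
    rw [abs_mul, abs_of_pos (inv_pos.2 Real.pi_pos), norm_mul, Complex.norm_real, norm_inv, norm_pow,
      Real.norm_eq_abs, div_eq_mul_inv, mul_assoc]
    gcongr
    exact Complex.abs_im_le_norm _
  · rw [Measure.restrict_apply measurableSet_Icc.compl]
    convert measure_empty (μ := μ)
    ext x
    simp only [mem_inter_iff, mem_compl_iff, mem_Icc, ← abs_le, mem_ofPred_eq, mem_empty_iff_false,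
      iff_false, not_and, not_not]
    intro hx
    linarith
  · rw [← restrict_eq_tailMeasure hh hG hs0 hsr (by linarith : s < s + 1),
      Measure.restrict_compl_add_restrict hT]

end Converse

end

/-- Theorem 4.1, (1) ⇔ (2): a probability measure `μ` belongs to `P₁` iff
`z ↦ G_μ(1/z)`, defined on the upper half-plane, extends analytically to a disc
`{|z| < r}` for some `r > 0`. -/
theorem memP1_iff_stieltjes_continuation
    (μ : Measure ℝ) (hprob : IsProbabilityMeasure μ) :
    memP1 μ ↔
      ∃ r : ℝ, 0 < r ∧ ∃ h : ℂ → ℂ,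
        AnalyticOnNhd ℂ h (Metric.ball (0 : ℂ) r) ∧
        ∀ z : ℂ, 0 < z.im → z ∈ Metric.ball (0 : ℂ) r → h z = stieltjes μ z⁻¹ := by
  refine ⟨fun hμ => hμ.exists_continuation, ?_⟩
  rintro ⟨r, hr, h, hh, hG⟩
  exact memP1_of_continuation hr hh hG
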